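/- Let X_1,…,X_N be jointly distributed random variables with values in a finite type V whose joint distribution is causally isotropic, let 1 ≤ i ≤ n < N, let W be a finite type and let f : V^i → W be any function. Then for every ω ∈ W with P(f(X_1,…,X_i) = ω) > 0, the pointwise conditional entropy satisfies H(X_{n+1} | f(X_1,…,X_i) = ω) ≥ H(X_{n+1} | (X_1,…,X_i)). -/

import Mathlib

open Finset

/-- Shannon entropy of a pmf `q` on a finite type, `H(q) = -∑ s, q s * log (q s)`
(with the convention `0 * log 0 = 0`, which holds since `Real.log 0 = 0`). -/
noncomputable def shannonEntropy {S : Type*} [Fintype S] (q : S → ℝ) : ℝ :=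
  -∑ s, q s * Real.log (q s)

/-- Marginal probability `P(X = a)` for a random variable `X` on a finite sample
space with joint pmf `p`. -/
noncomputable def probOf {Ω A : Type*} [Fintype Ω] [DecidableEq A]
    (p : Ω → ℝ) (X : Ω → A) (a : A) : ℝ :=
  ∑ ω, if X ω = a then p ω else 0

/-- Conditional pmf of `Y` given `X = a`: `b ↦ P(X = a, Y = b) / P(X = a)`. -/
noncomputable def condDist {Ω A B : Type*} [Fintype Ω] [DecidableEq A] [DecidableEq B]
    (p : Ω → ℝ) (X : Ω → A) (Y : Ω → B) (a : A) : B → ℝ :=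
  fun b => (∑ ω, if X ω = a ∧ Y ω = b then p ω else 0) / probOf p X a

/-- Conditional entropy `H(Y | X) = ∑_{a : P(X=a) > 0} P(X = a) · H(Y | X = a)`.
(Terms with `P(X = a) = 0` contribute `0` to the sum, so we may sum over all `a`.) -/
noncomputable def condEnt {Ω A B : Type*} [Fintype Ω] [Fintype A] [Fintype B]
    [DecidableEq A] [DecidableEq B] (p : Ω → ℝ) (X : Ω → A) (Y : Ω → B) : ℝ :=
  ∑ a, probOf p X a * shannonEntropy (condDist p X Y a)

/-- Mutual information `I(X;Y) = H(Y) - H(Y|X)`. -/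
noncomputable def mutInfo {Ω A B : Type*} [Fintype Ω] [Fintype A] [Fintype B]
    [DecidableEq A] [DecidableEq B] (p : Ω → ℝ) (X : Ω → A) (Y : Ω → B) : ℝ :=
  shannonEntropy (fun b => probOf p Y b) - condEnt p X Y

/-- The prefix `X_{≤i} = (X_1, …, X_i)` of the process `X_1, …, X_N`
(0-based: `X_k` is coordinate `k - 1`). -/
def prefixVar {N : ℕ} {V : Type*} (i : ℕ) (h : i ≤ N) : (Fin N → V) → Fin i → V :=
  fun ω k => ω (Fin.castLE h k)

/-- A joint pmf of `X_1, …, X_N` is *causally isotropic* if for every `n < N`,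
every index set `Λ ⊆ {1,…,n}` and any two positive-probability assignments
`xs, xs'` of values to the coordinates in `Λ`, the pointwise conditional entropies
`H(X_{n+1} | X_Λ = xs)` and `H(X_{n+1} | X_Λ = xs')` coincide. -/
def CausallyIsotropic {N : ℕ} {V : Type*} [Fintype V] [DecidableEq V]
    (p : (Fin N → V) → ℝ) : Prop :=
  ∀ (n : ℕ) (hn : n < N) (Λ : Finset (Fin N)), (∀ j ∈ Λ, (j : ℕ) < n) →
    ∀ xs xs' : {j // j ∈ Λ} → V,
      0 < probOf p (fun ω (j : {j // j ∈ Λ}) => ω j.1) xs →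
      0 < probOf p (fun ω (j : {j // j ∈ Λ}) => ω j.1) xs' →
      shannonEntropy
          (condDist p (fun ω (j : {j // j ∈ Λ}) => ω j.1) (fun ω => ω ⟨n, hn⟩) xs)
        = shannonEntropy
          (condDist p (fun ω (j : {j // j ∈ Λ}) => ω j.1) (fun ω => ω ⟨n, hn⟩) xs')

theorem probOf_nonneg {Ω A : Type*} [Fintype Ω] [DecidableEq A]
    {p : Ω → ℝ} (hp0 : ∀ x, 0 ≤ p x) (X : Ω → A) (a : A) : 0 ≤ probOf p X a :=
  Finset.sum_nonneg fun ω _ => by split_ifs <;> simp [hp0]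

theorem sum_probOf {Ω A : Type*} [Fintype Ω] [Fintype A] [DecidableEq A]
    (p : Ω → ℝ) (X : Ω → A) : ∑ a, probOf p X a = ∑ ω, p ω := by
  unfold probOf
  rw [Finset.sum_comm]
  simp

theorem probOf_comp {Ω A W : Type*} [Fintype Ω] [Fintype A] [DecidableEq A] [DecidableEq W]
    (p : Ω → ℝ) (X : Ω → A) (f : A → W) (w : W) :
    probOf p (fun ω => f (X ω)) w = ∑ a with f a = w, probOf p X a := by
  unfold probOf
  rw [Finset.sum_comm]
  refine Finset.sum_congr rfl fun ω _ => ?_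
  rw [Finset.sum_ite_eq]
  simp

theorem sum_joint_comp {Ω A B W : Type*} [Fintype Ω] [Fintype A] [DecidableEq A]
    [DecidableEq B] [DecidableEq W]
    (p : Ω → ℝ) (X : Ω → A) (Y : Ω → B) (f : A → W) (w : W) (b : B) :
    (∑ ω, if f (X ω) = w ∧ Y ω = b then p ω else 0)
      = ∑ a with f a = w, ∑ ω, if X ω = a ∧ Y ω = b then p ω else 0 := by
  rw [Finset.sum_comm]
  refine Finset.sum_congr rfl fun ω _ => ?_
  by_cases hb : Y ω = b <;> simp [hb]

theorem condDist_nonneg {Ω A B : Type*} [Fintype Ω] [DecidableEq A] [DecidableEq B]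
    {p : Ω → ℝ} (hp0 : ∀ x, 0 ≤ p x) (X : Ω → A) (Y : Ω → B) (a : A) (b : B) :
    0 ≤ condDist p X Y a b :=
  div_nonneg (Finset.sum_nonneg fun ω _ => by split_ifs <;> simp [hp0]) (probOf_nonneg hp0 X a)

theorem probOf_mul_condDist {Ω A B : Type*} [Fintype Ω] [DecidableEq A] [DecidableEq B]
    {p : Ω → ℝ} (hp0 : ∀ x, 0 ≤ p x) (X : Ω → A) (Y : Ω → B) (a : A) (b : B) :
    probOf p X a * condDist p X Y a b = ∑ ω, if X ω = a ∧ Y ω = b then p ω else 0 := by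
  unfold condDist
  by_cases h : probOf p X a = 0
  · have hle : (∑ ω, if X ω = a ∧ Y ω = b then p ω else 0) ≤ probOf p X a :=
      Finset.sum_le_sum fun ω _ => by
        by_cases h1 : X ω = a <;> by_cases h2 : Y ω = b <;> simp [h1, h2, hp0]
    have hge : 0 ≤ ∑ ω, if X ω = a ∧ Y ω = b then p ω else 0 :=
      Finset.sum_nonneg fun ω _ => by split_ifs <;> simp [hp0]
    rw [h, zero_mul]
    linarith
  · exact mul_div_cancel₀ _ h

theorem shannonEntropy_eq_sum_negMulLog {S : Type*} [Fintype S] (q : S → ℝ) :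
    shannonEntropy q = ∑ s, Real.negMulLog (q s) := by
  simp [shannonEntropy, Real.negMulLog]

/-- Concavity of entropy: conditioning on a coarser event has at least the average entropy of
the finer events composing it. -/
theorem sum_le_shannonEntropy_condDist_comp {Ω A B W : Type*} [Fintype Ω] [Fintype A] [Fintype B]
    [DecidableEq A] [DecidableEq B] [DecidableEq W] {p : Ω → ℝ} (hp0 : ∀ x, 0 ≤ p x)
    (X : Ω → A) (Y : Ω → B) (f : A → W) (w : W) (hw : 0 < probOf p (fun ω => f (X ω)) w) :
    ∑ a with f a = w,
        probOf p X a / probOf p (fun ω => f (X ω)) w * shannonEntropy (condDist p X Y a)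
      ≤ shannonEntropy (condDist p (fun ω => f (X ω)) Y w) := by
  simp_rw [shannonEntropy_eq_sum_negMulLog, Finset.mul_sum]
  rw [Finset.sum_comm]
  refine Finset.sum_le_sum fun b _ => ?_
  have hmix : condDist p (fun ω => f (X ω)) Y w b
      = ∑ a with f a = w,
        (probOf p X a / probOf p (fun ω => f (X ω)) w) • condDist p X Y a b := by
    simp_rw [smul_eq_mul, div_mul_eq_mul_div, probOf_mul_condDist hp0]
    rw [← Finset.sum_div, ← sum_joint_comp]
    rfl
  rw [hmix]
  refine Real.concaveOn_negMulLog.le_map_sum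
    (fun a _ => div_nonneg (probOf_nonneg hp0 X a) hw.le) ?_
    (fun a _ => condDist_nonneg hp0 X Y a b)
  rw [← Finset.sum_div, ← probOf_comp, div_self hw.ne']

theorem condEnt_eq_of_forall_eq {Ω A B : Type*} [Fintype Ω] [Fintype A] [Fintype B]
    [DecidableEq A] [DecidableEq B] {p : Ω → ℝ} (hp0 : ∀ x, 0 ≤ p x) (hp1 : ∑ x, p x = 1)
    (X : Ω → A) (Y : Ω → B) (h : ℝ)
    (hX : ∀ a, 0 < probOf p X a → shannonEntropy (condDist p X Y a) = h) :
    condEnt p X Y = h := by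
  have hterm : ∀ a, probOf p X a * shannonEntropy (condDist p X Y a) = probOf p X a * h := by
    intro a
    rcases (probOf_nonneg hp0 X a).eq_or_lt with h0 | h0
    · simp [← h0]
    · rw [hX a h0]
  simp_rw [condEnt, hterm]
  rw [← Finset.sum_mul, sum_probOf, hp1, one_mul]

theorem condEnt_le_shannonEntropy_condDist_comp {Ω A B W : Type*} [Fintype Ω] [Fintype A]
    [Fintype B] [DecidableEq A] [DecidableEq B] [DecidableEq W]
    {p : Ω → ℝ} (hp0 : ∀ x, 0 ≤ p x) (hp1 : ∑ x, p x = 1) (X : Ω → A) (Y : Ω → B)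
    (hX : ∀ a a', 0 < probOf p X a → 0 < probOf p X a' →
      shannonEntropy (condDist p X Y a) = shannonEntropy (condDist p X Y a'))
    (f : A → W) (w : W) (hw : 0 < probOf p (fun ω => f (X ω)) w) :
    condEnt p X Y ≤ shannonEntropy (condDist p (fun ω => f (X ω)) Y w) := by
  refine le_trans (le_of_eq ?_) (sum_le_shannonEntropy_condDist_comp hp0 X Y f w hw)
  have hterm : ∀ a,
      probOf p X a / probOf p (fun ω => f (X ω)) w * shannonEntropy (condDist p X Y a)
        = probOf p X a / probOf p (fun ω => f (X ω)) w * condEnt p X Y := by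
    intro a
    rcases (probOf_nonneg hp0 X a).eq_or_lt with h0 | h0
    · simp [← h0]
    · rw [condEnt_eq_of_forall_eq hp0 hp1 X Y _ fun a' ha' => hX a' a ha' h0]
  simp_rw [hterm]
  rw [← Finset.sum_mul, ← Finset.sum_div, ← probOf_comp, div_self hw.ne', one_mul]

theorem probOf_congr {Ω A A' : Type*} [Fintype Ω] [DecidableEq A] [DecidableEq A']
    (p : Ω → ℝ) {X : Ω → A} {X' : Ω → A'} {a : A} {a' : A'} (h : ∀ ω, X ω = a ↔ X' ω = a') :
    probOf p X a = probOf p X' a' := by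
  simp only [probOf, h]

theorem condDist_congr {Ω A A' B : Type*} [Fintype Ω] [DecidableEq A] [DecidableEq A']
    [DecidableEq B] (p : Ω → ℝ) {X : Ω → A} {X' : Ω → A'} (Y : Ω → B) {a : A} {a' : A'}
    (h : ∀ ω, X ω = a ↔ X' ω = a') : condDist p X Y a = condDist p X' Y a' := by
  funext b
  simp only [condDist, h, probOf_congr p h]

theorem CausallyIsotropic.shannonEntropy_prefixVar_eq {N : ℕ} {V : Type*}
    [Fintype V] [DecidableEq V] {p : (Fin N → V) → ℝ} (hiso : CausallyIsotropic p)
    {i n : ℕ} (hin : i ≤ n) (hn : n < N) (hiN : i ≤ N) (x x' : Fin i → V)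
    (hx : 0 < probOf p (prefixVar i hiN) x) (hx' : 0 < probOf p (prefixVar i hiN) x') :
    shannonEntropy (condDist p (prefixVar i hiN) (fun ω => ω ⟨n, hn⟩) x)
      = shannonEntropy (condDist p (prefixVar i hiN) (fun ω => ω ⟨n, hn⟩) x') := by
  let Λ : Finset (Fin N) := Finset.univ.filter fun j => (j : ℕ) < i
  have hΛ : ∀ j ∈ Λ, (j : ℕ) < i := fun j hj => (Finset.mem_filter.1 hj).2
  let ext : (Fin i → V) → {j // j ∈ Λ} → V := fun y j => y ⟨j.1, hΛ j.1 j.2⟩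
  have key : ∀ (y : Fin i → V) (ω : Fin N → V),
      prefixVar i hiN ω = y ↔ (fun j : {j // j ∈ Λ} => ω j.1) = ext y := by
    intro y ω
    constructor
    · rintro rfl
      rfl
    · intro h
      funext k
      exact congrFun h ⟨Fin.castLE hiN k, Finset.mem_filter.2 ⟨Finset.mem_univ _, k.2⟩⟩
  rw [condDist_congr p _ (key x), condDist_congr p _ (key x')]
  rw [probOf_congr p (key x)] at hx
  rw [probOf_congr p (key x')] at hx'
  exact hiso n hn Λ (fun j hj => (hΛ j hj).trans_le hin) _ _ hx hx'

/-- For causally isotropic data, the pointwise conditional entropy of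
the next token given any positive-probability value `w` of a deterministic function of
the prefix satisfies `H(X_{n+1} | f(X_1,…,X_i) = w) ≥ H(X_{n+1} | (X_1,…,X_i))`. -/
theorem pointwise_condEnt_ge_of_causallyIsotropic {N : ℕ} {V W : Type*}
    [Fintype V] [DecidableEq V] [Fintype W] [DecidableEq W]
    (p : (Fin N → V) → ℝ) (hp0 : ∀ x, 0 ≤ p x) (hp1 : ∑ x, p x = 1)
    (hiso : CausallyIsotropic p)
    (i n : ℕ) (hi : 1 ≤ i) (hin : i ≤ n) (hn : n < N)
    (f : (Fin i → V) → W) (w : W)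
    (hw : 0 < probOf p (fun ω => f (prefixVar i (by omega) ω)) w) :
    shannonEntropy
        (condDist p (fun ω => f (prefixVar i (by omega) ω)) (fun ω => ω ⟨n, hn⟩) w)
      ≥ condEnt p (prefixVar i (by omega)) (fun ω => ω ⟨n, hn⟩) := by
  exact condEnt_le_shannonEntropy_condDist_comp hp0 hp1 _ _
    (fun x x' hx hx' => hiso.shannonEntropy_prefixVar_eq hin hn _ x x' hx hx') f w hw
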